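/- arXiv:1410.1220 — 2 statements merged into one kernel-verified Lean document; each statement's English description precedes it below -/
import Mathlib

section
/- There exists a unique C¹ matrix-valued function R₂ : [0,T] → ℝ^{n×n} satisfying R₂'(t) + (R₂(t)ᵀ + R₂(t))A − Γ + (1/2)(R₂(t) + R₂(t)ᵀ)σσᵀ(R₂(t) + R₂(t)ᵀ) = 0 for all t ∈ [0,T] with R₂(T) = 0, and, given this R₂, there exists a unique C¹ row-vector-valued function R₁ : [0,T] → ℝ^{1×n} satisfying R₁'(t) + R₁(t)A + Bᵀ(R₂(t) + R₂(t)ᵀ) − R + R₁(t)σσᵀ(R₂(t) + R₂(t)ᵀ) = 0 for all t ∈ [0,T] with R₁(T) = 0. -/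
open Matrix Set

attribute [local instance] Matrix.normedAddCommGroup Matrix.normedSpace

section MatrixCalculus

variable {l m p : Type*} [Fintype m] [Fintype p]

theorem hasDerivWithinAt_matrix_iff {F : ℝ → Matrix l m ℝ} {F' : Matrix l m ℝ} {s : Set ℝ}
    {t : ℝ} : HasDerivWithinAt F F' s t ↔
      ∀ i j, HasDerivWithinAt (fun x => F x i j) (F' i j) s t := by
  refine (hasDerivWithinAt_pi (φ := F) (φ' := F')).trans (forall_congr' fun i => ?_)
  exact hasDerivWithinAt_pi (φ := fun x => F x i) (φ' := F' i)

theorem HasDerivWithinAt.matrix_mul {F : ℝ → Matrix l m ℝ} {G : ℝ → Matrix m p ℝ}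
    {F' : Matrix l m ℝ} {G' : Matrix m p ℝ} {s : Set ℝ} {t : ℝ}
    (hF : HasDerivWithinAt F F' s t) (hG : HasDerivWithinAt G G' s t) :
    HasDerivWithinAt (fun x => F x * G x) (F' * G t + F t * G') s t := by
  rw [hasDerivWithinAt_matrix_iff] at *
  intro i j
  simp only [Matrix.mul_apply, Matrix.add_apply, ← Finset.sum_add_distrib]
  exact HasDerivWithinAt.fun_sum fun k _ => (hF i k).mul (hG k j)

theorem HasDerivAt.matrix_mul [Fintype l] {F : ℝ → Matrix l m ℝ} {G : ℝ → Matrix m p ℝ}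
    {F' : Matrix l m ℝ} {G' : Matrix m p ℝ} {t : ℝ}
    (hF : HasDerivAt F F' t) (hG : HasDerivAt G G' t) :
    HasDerivAt (fun x => F x * G x) (F' * G t + F t * G') t :=
  hasDerivWithinAt_univ.1 (hF.hasDerivWithinAt.matrix_mul hG.hasDerivWithinAt)

theorem HasDerivWithinAt.matrix_transpose [Fintype l] {F : ℝ → Matrix l m ℝ} {F' : Matrix l m ℝ}
    {s : Set ℝ} {t : ℝ} (hF : HasDerivWithinAt F F' s t) :
    HasDerivWithinAt (fun x => (F x)ᵀ) F'ᵀ s t := by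
  rw [hasDerivWithinAt_matrix_iff] at *
  exact fun i j => hF j i

theorem HasDerivWithinAt.matrix_trace {F : ℝ → Matrix m m ℝ} {F' : Matrix m m ℝ}
    {s : Set ℝ} {t : ℝ} (hF : HasDerivWithinAt F F' s t) :
    HasDerivWithinAt (fun x => (F x).trace) F'.trace s t := by
  rw [hasDerivWithinAt_matrix_iff] at hF
  exact HasDerivWithinAt.fun_sum fun i _ => hF i i

theorem differentiableAt_matrix_det [DecidableEq m] {F : ℝ → Matrix m m ℝ} {t : ℝ}
    (hF : ∀ i j, DifferentiableAt ℝ (fun x => F x i j) t) :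
    DifferentiableAt ℝ (fun x => (F x).det) t := by
  simp only [Matrix.det_apply']
  exact DifferentiableAt.fun_sum fun g _ =>
    (DifferentiableAt.fun_finsetProd fun i _ => hF (g i) i).const_mul _

theorem differentiableAt_matrix_iff {F : ℝ → Matrix l m ℝ} {t : ℝ} :
    DifferentiableAt ℝ F t ↔ ∀ i j, DifferentiableAt ℝ (fun x => F x i j) t := by
  refine (differentiableAt_pi (Φ := F)).trans (forall_congr' fun i => ?_)
  exact differentiableAt_pi (Φ := fun x => F x i)

theorem DifferentiableAt.matrix_inv [DecidableEq m] {F : ℝ → Matrix m m ℝ} {t : ℝ}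
    (hF : DifferentiableAt ℝ F t) (h : (F t).det ≠ 0) :
    DifferentiableAt ℝ (fun x => (F x)⁻¹) t := by
  rw [differentiableAt_matrix_iff] at *
  intro i j
  simp only [Matrix.inv_def, Ring.inverse_eq_inv', Matrix.smul_apply, smul_eq_mul,
    Matrix.adjugate_apply]
  refine ((differentiableAt_matrix_det hF).inv h).mul (differentiableAt_matrix_det fun a b => ?_)
  by_cases ha : a = j
  · subst ha
    simp
  · simpa [Matrix.updateRow_ne ha] using hF a b

/-- The quotient rule for `X * U⁻¹`. -/
theorem HasDerivAt.matrix_mul_inv [Fintype l] [DecidableEq m]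
    {X : ℝ → Matrix l m ℝ} {U : ℝ → Matrix m m ℝ}
    {X' : Matrix l m ℝ} {U' : Matrix m m ℝ} {t : ℝ}
    (hX : HasDerivAt X X' t) (hU : HasDerivAt U U' t) (h : (U t).det ≠ 0) :
    HasDerivAt (fun x => X x * (U x)⁻¹) ((X' - X t * (U t)⁻¹ * U') * (U t)⁻¹) t := by
  obtain ⟨Y', hY⟩ : ∃ Y', HasDerivAt (fun x => (U x)⁻¹) Y' t :=
    ⟨_, (hU.differentiableAt.matrix_inv h).hasDerivAt⟩
  have hdet : ∀ᶠ x in nhds t, (U x).det ≠ 0 :=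
    (differentiableAt_matrix_det
      (differentiableAt_matrix_iff.1 hU.differentiableAt)).continuousAt.eventually_ne h
  have hprod := hU.matrix_mul hY
  have hone : HasDerivAt (fun x => U x * (U x)⁻¹) 0 t :=
    (hasDerivAt_const t (1 : Matrix m m ℝ)).congr_of_eventuallyEq
      (hdet.mono fun x hx => Matrix.mul_nonsing_inv _ (isUnit_iff_ne_zero.2 hx))
  have heq := hprod.unique hone
  have hY' : Y' = -((U t)⁻¹ * U' * (U t)⁻¹) := by
    have h1 : (U t)⁻¹ * (U' * (U t)⁻¹ + U t * Y') = 0 := by rw [heq, Matrix.mul_zero]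
    rw [Matrix.mul_add, Matrix.nonsing_inv_mul_cancel_left _ _ (isUnit_iff_ne_zero.2 h),
      ← Matrix.mul_assoc] at h1
    exact eq_neg_of_add_eq_zero_right h1
  have hres := hX.matrix_mul hY
  rw [hY'] at hres
  refine hres.congr_deriv ?_
  simp only [Matrix.sub_mul, Matrix.mul_neg, Matrix.mul_assoc, ← sub_eq_add_neg]

theorem norm_matrix_mul_le [Fintype l] (M : Matrix l m ℝ) (N : Matrix m p ℝ) :
    ‖M * N‖ ≤ Fintype.card m * ‖M‖ * ‖N‖ := by
  rw [Matrix.norm_le_iff (by positivity)]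
  intro i j
  rw [Matrix.mul_apply]
  calc ‖∑ k, M i k * N k j‖ ≤ ∑ k : m, ‖M‖ * ‖N‖ := by
        refine norm_sum_le_of_le _ fun k _ => ?_
        rw [norm_mul]
        gcongr <;> exact Matrix.norm_entry_le_entrywise_sup_norm _
    _ = _ := by simp [mul_assoc]

/-- A solution of a homogeneous linear equation on an interval that vanishes at one endpoint vanishes identically. -/
theorem eqOn_zero_of_hasDerivWithinAt_mul {M : ℝ → Matrix m m ℝ} {D : ℝ → Matrix m p ℝ}
    {a b : ℝ} (hM : ContinuousOn M (Icc a b))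
    (hD : ∀ t ∈ Icc a b, HasDerivWithinAt D (M t * D t) (Icc a b) t)
    (h0 : D a = 0 ∨ D b = 0) : ∀ t ∈ Icc a b, D t = 0 := by
  obtain ⟨C, hC⟩ := isCompact_Icc.exists_bound_of_continuousOn hM
  have hlip : ∀ t ∈ Icc a b, LipschitzOnWith (Fintype.card m * C.toNNReal)
      (fun N : Matrix m p ℝ => M t * N) univ := by
    intro t ht
    refine LipschitzOnWith.of_dist_le_mul fun N _ N' _ => ?_
    rw [dist_eq_norm, dist_eq_norm, ← Matrix.mul_sub]
    refine (norm_matrix_mul_le _ _).trans ?_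
    push_cast
    gcongr
    exact (hC t ht).trans (Real.le_coe_toNNReal C)
  have hcont : ContinuousOn D (Icc a b) := fun t ht => (hD t ht).continuousWithinAt
  have hzero (s : Set ℝ) (t : ℝ) :
      HasDerivWithinAt (fun _ => (0 : Matrix m p ℝ)) (M t * (0 : Matrix m p ℝ)) s t := by
    rw [Matrix.mul_zero]
    exact hasDerivWithinAt_const _ _ _
  rcases h0 with h0 | h0
  · exact ODE_solution_unique_of_mem_Icc_right (v := fun t N => M t * N) (s := fun _ => univ)
      (fun t ht => hlip t (Ico_subset_Icc_self ht)) hcont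
      (fun t ht => (hD t (Ico_subset_Icc_self ht)).mono_of_mem_nhdsWithin
        (Icc_mem_nhdsGE_of_mem ht))
      (fun _ _ => mem_univ _) continuousOn_const (fun t _ => hzero _ t)
      (fun _ _ => mem_univ _) h0
  · exact ODE_solution_unique_of_mem_Icc_left (v := fun t N => M t * N) (s := fun _ => univ)
      (fun t ht => hlip t (Ioc_subset_Icc_self ht)) hcont
      (fun t ht => (hD t (Ioc_subset_Icc_self ht)).mono_of_mem_nhdsWithin
        (Icc_mem_nhdsLE_of_mem ht))
      (fun _ _ => mem_univ _) continuousOn_const (fun t _ => hzero _ t)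
      (fun _ _ => mem_univ _) h0

end MatrixCalculus

/-- Global solvability of autonomous linear differential equations. -/
theorem exists_hasDerivAt_clm {E : Type*} [NormedAddCommGroup E] [NormedSpace ℝ E]
    [CompleteSpace E] (L : E →L[ℝ] E) (T : ℝ) (x₀ : E) :
    ∃ X : ℝ → E, X T = x₀ ∧ ∀ t, HasDerivAt X (L (X t)) t := by
  refine ⟨fun t => NormedSpace.exp ((t - T) • L) x₀, by simp, fun t => ?_⟩
  have h := (hasDerivAt_exp_smul_const' (𝕂 := ℝ) L (t - T)).comp_sub_const t T
  exact ((ContinuousLinearMap.apply ℝ E x₀).hasFDerivAt.comp_hasDerivAt t h)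

/-- The linear Hamiltonian system whose quotient `W * U⁻¹` solves a matrix Riccati equation. -/
theorem exists_hamiltonian_flow {n : ℕ} (A Q G : Matrix (Fin n) (Fin n) ℝ) (T : ℝ) :
    ∃ U W : ℝ → Matrix (Fin n) (Fin n) ℝ, U T = 1 ∧ W T = 0 ∧
      (∀ t, HasDerivAt U (A * U t + Q * W t) t) ∧
      ∀ t, HasDerivAt W (G * U t - Aᵀ * W t) t := by
  let L : Matrix (Fin n) (Fin n) ℝ × Matrix (Fin n) (Fin n) ℝ →ₗ[ℝ]
      Matrix (Fin n) (Fin n) ℝ × Matrix (Fin n) (Fin n) ℝ :=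
    { toFun := fun z => (A * z.1 + Q * z.2, G * z.1 - Aᵀ * z.2)
      map_add' := fun x y => by
        simp only [Prod.fst_add, Prod.snd_add, Matrix.mul_add, Prod.mk_add_mk, Prod.mk.injEq]
        constructor <;> abel
      map_smul' := fun c x => by
        simp [smul_sub, smul_add] }
  obtain ⟨X, hXT, hX⟩ := exists_hasDerivAt_clm (LinearMap.toContinuousLinearMap L) T (1, 0)
  refine ⟨fun t => (X t).1, fun t => (X t).2, by simp [hXT], by simp [hXT], fun t => ?_,
    fun t => ?_⟩
  · exact (ContinuousLinearMap.fst ℝ _ _).hasFDerivAt.comp_hasDerivAt t (hX t)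
  · exact (ContinuousLinearMap.snd ℝ _ _).hasFDerivAt.comp_hasDerivAt t (hX t)

section Riccati

variable {n : ℕ} {A Q G : Matrix (Fin n) (Fin n) ℝ} {U W : ℝ → Matrix (Fin n) (Fin n) ℝ} {T : ℝ}

/-- The first component of the Hamiltonian flow stays invertible before the terminal time. -/
theorem det_ne_zero_of_hamiltonian_flow {σ : Matrix (Fin n) (Fin n) ℝ} (hG : G.PosSemidef)
    (hUT : U T = 1) (hWT : W T = 0)
    (hU : ∀ t, HasDerivAt U (A * U t + σ * σᵀ * W t) t)
    (hW : ∀ t, HasDerivAt W (G * U t - Aᵀ * W t) t) {t₀ : ℝ} (ht₀ : t₀ < T) :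
    (U t₀).det ≠ 0 := by
  intro hdet
  obtain ⟨x, hx, hx0⟩ := Matrix.exists_mulVec_eq_zero_iff.2 hdet
  set X : Matrix (Fin n) (Fin 1) ℝ := replicateCol (Fin 1) x with hXdef
  have hUX : U t₀ * X = 0 := by
    rw [hXdef, ← Matrix.replicateCol_mulVec, hx0]
    rfl
  have hu (t : ℝ) : HasDerivAt (fun s => U s * X) (A * (U t * X) + σ * σᵀ * (W t * X)) t := by
    refine ((hU t).matrix_mul (hasDerivAt_const t X)).congr_deriv ?_
    simp only [Matrix.mul_zero, add_zero, Matrix.add_mul, Matrix.mul_assoc]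
  have hw (t : ℝ) : HasDerivAt (fun s => W s * X) (G * (U t * X) - Aᵀ * (W t * X)) t := by
    refine ((hW t).matrix_mul (hasDerivAt_const t X)).congr_deriv ?_
    simp only [Matrix.mul_zero, add_zero, Matrix.sub_mul, Matrix.mul_assoc]
  set u : ℝ → Matrix (Fin n) (Fin 1) ℝ := fun s => U s * X with hu_def
  set w : ℝ → Matrix (Fin n) (Fin 1) ℝ := fun s => W s * X with hw_def
  -- the pairing of the two components is nondecreasing along the flow
  have hφ (t : ℝ) : HasDerivAt (fun s => ((u s)ᵀ * w s).trace)
      (((u t)ᵀ * G * u t).trace + ((σᵀ * w t)ᵀ * (σᵀ * w t)).trace) t := by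
    rw [← hasDerivWithinAt_univ]
    refine ((hu t).hasDerivWithinAt.matrix_transpose.matrix_mul
      (hw t).hasDerivWithinAt).matrix_trace.congr_deriv ?_
    rw [← Matrix.trace_add]
    congr 1
    simp only [hu_def, hw_def, Matrix.transpose_add, Matrix.transpose_mul,
      Matrix.transpose_transpose, Matrix.add_mul, Matrix.mul_sub, Matrix.mul_assoc]
    abel
  have hG0 (t : ℝ) : 0 ≤ ((u t)ᵀ * G * u t).trace := by
    simpa using (hG.conjTranspose_mul_mul_same (u t)).trace_nonneg
  have hσ0 (t : ℝ) : 0 ≤ ((σᵀ * w t)ᵀ * (σᵀ * w t)).trace := by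
    simpa using (Matrix.posSemidef_conjTranspose_mul_self (σᵀ * w t)).trace_nonneg
  have hmono : Monotone fun s => ((u s)ᵀ * w s).trace :=
    monotone_of_deriv_nonneg (fun t => (hφ t).differentiableAt) fun t => by
      rw [(hφ t).deriv]
      exact add_nonneg (hG0 t) (hσ0 t)
  have hφ0 : ∀ t ∈ Icc t₀ T, ((u t)ᵀ * w t).trace = 0 := by
    intro t ht
    refine le_antisymm ((hmono ht.2).trans_eq ?_) (Eq.trans_le ?_ (hmono ht.1))
    · simp [hw_def, hWT]
    · simp [hu_def, hUX]
  have hσw : ∀ t ∈ Icc t₀ T, σᵀ * w t = 0 := by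
    intro t ht
    have h0 : HasDerivWithinAt (fun s => ((u s)ᵀ * w s).trace) 0 (Icc t₀ T) t :=
      (hasDerivWithinAt_const t (Icc t₀ T) (0 : ℝ)).congr hφ0 (hφ0 t ht)
    have heq := (uniqueDiffOn_Icc ht₀ t ht).eq_deriv _ (hφ t).hasDerivWithinAt h0
    have htr : ((σᵀ * w t)ᵀ * (σᵀ * w t)).trace = 0 := by linarith [hG0 t, hσ0 t]
    refine Matrix.trace_conjTranspose_mul_self_eq_zero_iff.1 ?_
    simpa using htr
  have huT := eqOn_zero_of_hasDerivWithinAt_mul (M := fun _ => A) (D := u) (a := t₀) (b := T)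
    continuousOn_const (fun t ht => by
      have h := (hu t).hasDerivWithinAt (s := Icc t₀ T)
      have hz : σ * σᵀ * (W t * X) = 0 := by
        rw [Matrix.mul_assoc, hσw t ht, Matrix.mul_zero]
      rwa [hz, add_zero] at h) (Or.inl hUX) T (right_mem_Icc.2 ht₀.le)
  apply hx
  ext i
  have := congrFun (congrFun huT i) 0
  simpa [hu_def, hUT, hXdef] using this

theorem transpose_mul_eq_of_hamiltonian_flow (hG : Gᵀ = G) (hQ : Qᵀ = Q)
    (hWT : W T = 0) (hU : ∀ t, HasDerivAt U (A * U t + Q * W t) t)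
    (hW : ∀ t, HasDerivAt W (G * U t - Aᵀ * W t) t) {t : ℝ} (ht : t ≤ T) :
    (W t)ᵀ * U t = (U t)ᵀ * W t := by
  refine sub_eq_zero.1 (eqOn_zero_of_hasDerivWithinAt_mul (M := fun _ => 0)
    (D := fun s => (W s)ᵀ * U s - (U s)ᵀ * W s) (a := t) (b := T) continuousOn_const
    (fun s _ => ?_) (Or.inr (by simp [hWT])) t (left_mem_Icc.2 ht))
  have hUs := (hU s).hasDerivWithinAt (s := Icc t T)
  have hWs := (hW s).hasDerivWithinAt (s := Icc t T)
  refine ((hWs.matrix_transpose.matrix_mul hUs).sub (hUs.matrix_transpose.matrix_mul hWs)).congr_deriv ?_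
  simp only [Matrix.transpose_add, Matrix.transpose_sub, Matrix.transpose_mul, hG, hQ,
    Matrix.transpose_transpose, Matrix.add_mul, Matrix.sub_mul, Matrix.mul_add, Matrix.mul_sub,
    Matrix.mul_assoc, Matrix.zero_mul]
  abel

theorem transpose_mul_inv_eq {U W : Matrix (Fin n) (Fin n) ℝ} (hdet : U.det ≠ 0)
    (h : Wᵀ * U = Uᵀ * W) : (W * U⁻¹)ᵀ = W * U⁻¹ := by
  have hu : IsUnit U.det := isUnit_iff_ne_zero.2 hdet
  have hut : IsUnit Uᵀ.det := by rwa [Matrix.det_transpose]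
  have hW : Wᵀ = Uᵀ * (W * U⁻¹) := by
    rw [← Matrix.mul_assoc, ← h, Matrix.mul_nonsing_inv_cancel_right _ _ hu]
  rw [Matrix.transpose_mul, hW, Matrix.transpose_nonsing_inv,
    Matrix.nonsing_inv_mul_cancel_left _ _ hut]

theorem hasDerivAt_riccati_of_hamiltonian_flow {t : ℝ} (hdet : (U t).det ≠ 0)
    (hU : HasDerivAt U (A * U t + Q * W t) t) (hW : HasDerivAt W (G * U t - Aᵀ * W t) t) :
    HasDerivAt (fun s => W s * (U s)⁻¹) (G - Aᵀ * (W t * (U t)⁻¹) - W t * (U t)⁻¹ * A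
      - W t * (U t)⁻¹ * Q * (W t * (U t)⁻¹)) t := by
  refine (hW.matrix_mul_inv hU hdet).congr_deriv ?_
  have hu : IsUnit (U t).det := isUnit_iff_ne_zero.2 hdet
  simp only [Matrix.sub_mul, Matrix.mul_add, Matrix.add_mul, Matrix.mul_assoc,
    Matrix.mul_nonsing_inv _ hu, Matrix.mul_one]
  abel

/-- A solution `S` of the Riccati equation coincides with `W * U⁻¹`. -/
theorem eqOn_mul_inv_of_riccati {a : ℝ} {S : ℝ → Matrix (Fin n) (Fin n) ℝ}
    (hWT : W T = 0) (hU : ∀ t, HasDerivAt U (A * U t + Q * W t) t)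
    (hW : ∀ t, HasDerivAt W (G * U t - Aᵀ * W t) t) (hdet : ∀ t ∈ Icc a T, (U t).det ≠ 0)
    (hS : ∀ t ∈ Icc a T, HasDerivWithinAt S (G - Aᵀ * S t - S t * A - S t * Q * S t) (Icc a T) t)
    (hST : S T = 0) : EqOn S (fun t => W t * (U t)⁻¹) (Icc a T) := by
  have hcont : ContinuousOn S (Icc a T) := fun t ht => (hS t ht).continuousWithinAt
  intro t ht
  have h := eqOn_zero_of_hasDerivWithinAt_mul (M := fun s => -(Aᵀ + S s * Q))
    (D := fun s => S s * U s - W s) (a := a) (b := T)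
    ((continuousOn_const.add (hcont.mul continuousOn_const)).neg) (fun s hs => by
      refine (((hS s hs).matrix_mul (hU s).hasDerivWithinAt).sub (hW s).hasDerivWithinAt).congr_deriv ?_
      simp only [Matrix.neg_mul, Matrix.sub_mul, Matrix.mul_add, Matrix.mul_sub, Matrix.add_mul,
        Matrix.mul_assoc]
      abel) (Or.inr (by simp [hST, hWT])) t ht
  change S t = W t * (U t)⁻¹
  rw [← sub_eq_zero.1 h,
    Matrix.mul_nonsing_inv_cancel_right _ _ (isUnit_iff_ne_zero.2 (hdet t ht))]

theorem contDiffOn_one_of_hasDerivWithinAt {E : Type*} [NormedAddCommGroup E] [NormedSpace ℝ E]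
    {f f' : ℝ → E} {a b : ℝ} (hab : a < b)
    (hf : ∀ t ∈ Icc a b, HasDerivWithinAt f (f' t) (Icc a b) t)
    (hf' : ContinuousOn f' (Icc a b)) : ContDiffOn ℝ 1 f (Icc a b) := by
  rw [show (1 : WithTop ℕ∞) = 0 + 1 by rfl, contDiffOn_succ_iff_derivWithin (uniqueDiffOn_Icc hab)]
  refine ⟨fun t ht => (hf t ht).differentiableWithinAt, by simp, ?_⟩
  rw [contDiffOn_zero]
  exact hf'.congr fun t ht => (hf t ht).derivWithin (uniqueDiffOn_Icc hab t ht)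

theorem exists_hasDerivAt_of_continuousOn {E : Type*} [NormedAddCommGroup E] [NormedSpace ℝ E]
    [CompleteSpace E] {f : ℝ → E} {a b : ℝ} (hab : a ≤ b) (hf : ContinuousOn f (Icc a b)) :
    ∃ F : ℝ → E, F b = 0 ∧ ∀ t ∈ Icc a b, HasDerivAt F (f t) t := by
  have hg : Continuous (IccExtend hab (domRestrict (Icc a b) f)) := hf.domRestrict.Icc_extend'
  refine ⟨fun t => ∫ s in b..t, IccExtend hab (domRestrict (Icc a b) f) s, by simp, fun t ht => ?_⟩
  have h := (hg.integral_hasStrictDerivAt b t).hasDerivAt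
  rwa [IccExtend_of_mem hab _ ht] at h

end Riccati

/-- Existence and uniqueness on `[0,T]` of C¹ solutions `R₂`, `R₁` to the
Riccati-type terminal value problems associated with the bond price in the QTSM. -/
theorem statement1 (n : ℕ) (hn : 1 ≤ n) (T : ℝ) (hT : 0 < T)
    (A σ : Matrix (Fin n) (Fin n) ℝ) (B : Matrix (Fin n) (Fin 1) ℝ)
    (R : Matrix (Fin 1) (Fin n) ℝ)
    (Γ : Matrix (Fin n) (Fin n) ℝ) (hΓ : Γ.PosSemidef) :
    ∃ R₂ : ℝ → Matrix (Fin n) (Fin n) ℝ,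
      (ContDiffOn ℝ 1 R₂ (Icc 0 T) ∧
        (∀ t ∈ Icc 0 T,
          derivWithin R₂ (Icc 0 T) t + ((R₂ t)ᵀ + R₂ t) * A - Γ
            + (1 / 2 : ℝ) • ((R₂ t + (R₂ t)ᵀ) * (σ * σᵀ) * (R₂ t + (R₂ t)ᵀ)) = 0) ∧
        R₂ T = 0) ∧
      (∀ S : ℝ → Matrix (Fin n) (Fin n) ℝ,
        (ContDiffOn ℝ 1 S (Icc 0 T) ∧
          (∀ t ∈ Icc 0 T,
            derivWithin S (Icc 0 T) t + ((S t)ᵀ + S t) * A - Γ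
              + (1 / 2 : ℝ) • ((S t + (S t)ᵀ) * (σ * σᵀ) * (S t + (S t)ᵀ)) = 0) ∧
          S T = 0) → EqOn S R₂ (Icc 0 T)) ∧
      ∃ R₁ : ℝ → Matrix (Fin 1) (Fin n) ℝ,
        (ContDiffOn ℝ 1 R₁ (Icc 0 T) ∧
          (∀ t ∈ Icc 0 T,
            derivWithin R₁ (Icc 0 T) t + R₁ t * A + Bᵀ * (R₂ t + (R₂ t)ᵀ) - R
              + R₁ t * (σ * σᵀ) * (R₂ t + (R₂ t)ᵀ) = 0) ∧
          R₁ T = 0) ∧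
        (∀ S₁ : ℝ → Matrix (Fin 1) (Fin n) ℝ,
          (ContDiffOn ℝ 1 S₁ (Icc 0 T) ∧
            (∀ t ∈ Icc 0 T,
              derivWithin S₁ (Icc 0 T) t + S₁ t * A + Bᵀ * (R₂ t + (R₂ t)ᵀ) - R
                + S₁ t * (σ * σᵀ) * (R₂ t + (R₂ t)ᵀ) = 0) ∧
            S₁ T = 0) → EqOn S₁ R₁ (Icc 0 T)) := by
  have hG : ((2 : ℝ) • Γ).PosSemidef := hΓ.smul zero_le_two
  have hΓt : Γᵀ = Γ := by simpa using hΓ.isHermitian.eq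
  have hQt : (σ * σᵀ)ᵀ = σ * σᵀ := by simp
  obtain ⟨U, W, hUT, hWT, hU, hW⟩ := exists_hamiltonian_flow A (σ * σᵀ) ((2 : ℝ) • Γ) T
  have hdet : ∀ t ∈ Icc 0 T, (U t).det ≠ 0 := by
    intro t ht
    rcases ht.2.eq_or_lt with rfl | h
    · simp [hUT]
    · exact det_ne_zero_of_hamiltonian_flow hG hUT hWT hU hW h
  have hP (t : ℝ) (ht : t ∈ Icc 0 T) :=
    hasDerivAt_riccati_of_hamiltonian_flow (hdet t ht) (hU t) (hW t)
  have hPt : ∀ t ∈ Icc 0 T, (W t * (U t)⁻¹)ᵀ = W t * (U t)⁻¹ := fun t ht =>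
    transpose_mul_inv_eq (hdet t ht)
      (transpose_mul_eq_of_hamiltonian_flow (by simp [hΓt]) hQt hWT hU hW ht.2)
  obtain ⟨P, hPdef⟩ : ∃ P : ℝ → Matrix (Fin n) (Fin n) ℝ, P = fun t => W t * (U t)⁻¹ := ⟨_, rfl⟩
  have hPU : ∀ t ∈ Icc 0 T, P t * U t = W t := fun t ht => by
    rw [hPdef]
    exact Matrix.nonsing_inv_mul_cancel_right _ _ (isUnit_iff_ne_zero.2 (hdet t ht))
  have hPuniq : ∀ S : ℝ → Matrix (Fin n) (Fin n) ℝ,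
      (∀ t ∈ Icc 0 T, HasDerivWithinAt S ((2 : ℝ) • Γ - Aᵀ * S t - S t * A
        - S t * (σ * σᵀ) * S t) (Icc 0 T) t) → S T = 0 → EqOn S P (Icc 0 T) := by
    rw [hPdef]
    exact fun S hS hST => eqOn_mul_inv_of_riccati hWT hU hW hdet hS hST
  simp only [← congrFun hPdef] at hP hPt
  have hPc : ContinuousOn P (Icc 0 T) := fun t ht => (hP t ht).continuousAt.continuousWithinAt
  have hud := uniqueDiffOn_Icc hT
  have hFc : ContinuousOn (fun t => Γ - P t * A - (1 / 2 : ℝ) • (P t * (σ * σᵀ) * P t))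
      (Icc 0 T) :=
    (continuousOn_const.sub (hPc.mul continuousOn_const)).sub
      (((hPc.mul continuousOn_const).mul hPc).const_smul (1 / 2 : ℝ))
  obtain ⟨R₂, hR₂T, hR₂⟩ := exists_hasDerivAt_of_continuousOn hT.le hFc
  have hzero {p : Type} [Fintype p] {D : ℝ → Matrix p (Fin n) ℝ}
      (hD : ∀ t ∈ Icc 0 T, HasDerivWithinAt D 0 (Icc 0 T) t) (hDT : D T = 0) :
      ∀ t ∈ Icc 0 T, D t = 0 :=
    eqOn_zero_of_hasDerivWithinAt_mul (M := fun _ => 0) continuousOn_const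
      (fun t ht => by simpa using hD t ht) (Or.inr hDT)
  have hsum : ∀ t ∈ Icc 0 T, R₂ t + (R₂ t)ᵀ = P t := by
    intro t ht
    refine sub_eq_zero.1 (hzero (D := fun s => R₂ s + (R₂ s)ᵀ - P s) (fun s hs => ?_)
      (by simp [hR₂T, hPdef, hWT]) t ht)
    have h := (hR₂ s hs).hasDerivWithinAt (s := Icc 0 T)
    refine ((h.add h.matrix_transpose).sub (hP s hs).hasDerivWithinAt).congr_deriv ?_
    simp only [Matrix.transpose_sub, Matrix.transpose_smul, Matrix.transpose_mul, hΓt, hPt s hs,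
      Matrix.transpose_transpose, Matrix.mul_assoc]
    module
  have hsum' : ∀ t ∈ Icc 0 T, (R₂ t)ᵀ + R₂ t = P t := fun t ht => by
    rw [add_comm, hsum t ht]
  refine ⟨R₂, ⟨contDiffOn_one_of_hasDerivWithinAt hT
    (fun t ht => (hR₂ t ht).hasDerivWithinAt) hFc, fun t ht => ?_, hR₂T⟩, ?_, ?_⟩
  · have hd : derivWithin R₂ (Icc 0 T) t = Γ - P t * A - (1 / 2 : ℝ) • (P t * (σ * σᵀ) * P t) :=
      (hR₂ t ht).hasDerivWithinAt.derivWithin (hud t ht)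
    rw [hd, hsum t ht, hsum' t ht]
    abel
  · rintro S ⟨hS, hSeq, hST⟩
    have hS' : ∀ t ∈ Icc 0 T, HasDerivWithinAt S (Γ - (S t + (S t)ᵀ) * A
        - (1 / 2 : ℝ) • ((S t + (S t)ᵀ) * (σ * σᵀ) * (S t + (S t)ᵀ))) (Icc 0 T) t := by
      intro t ht
      have hd : HasDerivWithinAt S (derivWithin S (Icc 0 T) t) (Icc 0 T) t :=
        (hS.differentiableOn one_ne_zero t ht).hasDerivWithinAt
      refine hd.congr_deriv ?_
      rw [← sub_eq_zero, ← hSeq t ht, add_comm (S t)ᵀ]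
      abel
    have hSP := hPuniq (fun t => S t + (S t)ᵀ) (fun t ht => by
      have h := hS' t ht
      refine (h.add h.matrix_transpose).congr_deriv ?_
      have hsymm : (S t + (S t)ᵀ)ᵀ = S t + (S t)ᵀ := by
        rw [Matrix.transpose_add, Matrix.transpose_transpose, add_comm]
      generalize S t + (S t)ᵀ = Z at hsymm
      simp only [Matrix.transpose_sub, Matrix.transpose_smul, Matrix.transpose_mul, hΓt, hsymm,
        Matrix.transpose_transpose, Matrix.mul_assoc]
      module) (by simp [hST])
    intro t ht
    refine sub_eq_zero.1 (hzero (D := fun s => S s - R₂ s) (fun s hs => ?_)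
      (by simp [hST, hR₂T]) t ht)
    refine ((hS' s hs).sub (hR₂ s hs).hasDerivWithinAt).congr_deriv ?_
    rw [show S s + (S s)ᵀ = P s from hSP hs, sub_self]
  · have hUc : Continuous U := continuous_iff_continuousAt.2 fun t => (hU t).continuousAt
    have hWc : Continuous W := continuous_iff_continuousAt.2 fun t => (hW t).continuousAt
    have hIc : Continuous fun t => R * U t - Bᵀ * W t :=
      (continuous_const.matrix_mul hUc).sub (continuous_const.matrix_mul hWc)
    obtain ⟨I, hIT, hI⟩ := exists_hasDerivAt_of_continuousOn hT.le hIc.continuousOn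
    have hR₁ : ∀ t ∈ Icc 0 T, HasDerivAt (fun s => I s * (U s)⁻¹)
        (R - Bᵀ * P t - I t * (U t)⁻¹ * A - I t * (U t)⁻¹ * (σ * σᵀ) * P t) t := by
      intro t ht
      refine ((hI t ht).matrix_mul_inv (hU t) (hdet t ht)).congr_deriv ?_
      have hu : IsUnit (U t).det := isUnit_iff_ne_zero.2 (hdet t ht)
      simp only [hPdef, Matrix.sub_mul, Matrix.mul_add, Matrix.add_mul, Matrix.mul_assoc,
        Matrix.mul_nonsing_inv _ hu, Matrix.mul_one]
      abel
    have hR₁c : ContinuousOn (fun s => I s * (U s)⁻¹) (Icc 0 T) := fun t ht =>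
      (hR₁ t ht).continuousAt.continuousWithinAt
    have hmul {l m p : Type} [Fintype m] {F : ℝ → Matrix l m ℝ}
        {H : ℝ → Matrix m p ℝ} (hF : ContinuousOn F (Icc 0 T)) (hH : ContinuousOn H (Icc 0 T)) :
        ContinuousOn (fun t => F t * H t) (Icc 0 T) := by
      rw [continuousOn_iff_continuous_domRestrict] at *
      exact hF.matrix_mul hH
    refine ⟨fun s => I s * (U s)⁻¹, ⟨contDiffOn_one_of_hasDerivWithinAt hT
      (fun t ht => (hR₁ t ht).hasDerivWithinAt) ?_, fun t ht => ?_, by simp [hIT]⟩, ?_⟩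
    · exact ((continuousOn_const.sub (hmul continuousOn_const hPc)).sub
        (hmul hR₁c continuousOn_const)).sub (hmul (hmul hR₁c continuousOn_const) hPc)
    · have hd : derivWithin (fun s => I s * (U s)⁻¹) (Icc 0 T) t
          = R - Bᵀ * P t - I t * (U t)⁻¹ * A - I t * (U t)⁻¹ * (σ * σᵀ) * P t :=
        (hR₁ t ht).hasDerivWithinAt.derivWithin (hud t ht)
      rw [hd, hsum t ht]
      abel
    · rintro S ⟨hS, hSeq, hST⟩ t ht
      have h := hzero (D := fun s => S s * U s - I s) (fun s hs => by
        have hS' : HasDerivWithinAt S (derivWithin S (Icc 0 T) s) (Icc 0 T) s :=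
          (hS.differentiableOn one_ne_zero s hs).hasDerivWithinAt
        have heq : derivWithin S (Icc 0 T) s
            = R - Bᵀ * P s - S s * A - S s * (σ * σᵀ) * P s := by
          rw [← sub_eq_zero, ← hSeq s hs, hsum s hs]
          abel
        rw [heq] at hS'
        refine ((hS'.matrix_mul (hU s).hasDerivWithinAt).sub
          (hI s hs).hasDerivWithinAt).congr_deriv ?_
        simp only [← hPU s hs, Matrix.sub_mul, Matrix.mul_add, Matrix.mul_assoc]
        abel) (by simp [hST, hIT]) t ht
      change S t = I t * (U t)⁻¹
      rw [← sub_eq_zero.1 h,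
        Matrix.mul_nonsing_inv_cancel_right _ _ (isUnit_iff_ne_zero.2 (hdet t ht))]
end

section
/- There exists a unique C¹ matrix-valued function R₂ᶠ : [0,T] → ℝ^{n×n} satisfying R₂ᶠ'(t) + (R₂ᶠ(t)ᵀ + R₂ᶠ(t))A + (1/2)(R₂ᶠ(t)ᵀ + R₂ᶠ(t))σσᵀ(R₂ᶠ(t)ᵀ + R₂ᶠ(t)) − Γ = 0 for all t ∈ [0,T] with R₂ᶠ(T) = Θ, and, given this R₂ᶠ, there exists a unique C¹ row-vector-valued function R₁ᶠ : [0,T] → ℝ^{1×n} satisfying R₁ᶠ'(t) + R₁ᶠ(t)A + Bᵀ(R₂ᶠ(t)ᵀ + R₂ᶠ(t)) + R₁ᶠ(t)σσᵀ(R₂ᶠ(t)ᵀ + R₂ᶠ(t)) − R = 0 for all t ∈ [0,T] with R₁ᶠ(T) = θ. -/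
open Matrix Set

attribute [local instance] Matrix.normedAddCommGroup Matrix.normedSpace

open Filter Topology

section MatrixCalculus

variable {l m n : Type*} [Fintype l] [Fintype m] [Fintype n]

/-- Matrix multiplication as a continuous bilinear map. -/
noncomputable def matrixMulCLM (l m n : Type*) [Fintype l] [Fintype m] [Fintype n] :
    Matrix l m ℝ →L[ℝ] Matrix m n ℝ →L[ℝ] Matrix l n ℝ :=
  (LinearMap.mk₂ ℝ (fun (M : Matrix l m ℝ) (N : Matrix m n ℝ) ↦ M * N)
    Matrix.add_mul Matrix.smul_mul Matrix.mul_add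
    (fun c M N ↦ Matrix.mul_smul M c N)).toContinuousBilinearMap

/-- Matrix transposition as a continuous linear map. -/
noncomputable def matrixTransposeCLM (m n : Type*) [Fintype m] [Fintype n] :
    Matrix m n ℝ →L[ℝ] Matrix n m ℝ :=
  (Matrix.transposeLinearEquiv m n ℝ ℝ).toLinearMap.toContinuousLinearMap

theorem HasDerivAt.matrixMul {M : ℝ → Matrix l m ℝ} {N : ℝ → Matrix m n ℝ}
    {M' : Matrix l m ℝ} {N' : Matrix m n ℝ} {t : ℝ}
    (hM : HasDerivAt M M' t) (hN : HasDerivAt N N' t) :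
    HasDerivAt (fun s ↦ M s * N s) (M t * N' + M' * N t) t :=
  (matrixMulCLM l m n).hasDerivAt_of_bilinear (fun _ ↦ hM) (fun _ ↦ hN)

theorem HasDerivWithinAt.matrixMul {M : ℝ → Matrix l m ℝ} {N : ℝ → Matrix m n ℝ}
    {M' : Matrix l m ℝ} {N' : Matrix m n ℝ} {s : Set ℝ} {t : ℝ}
    (hM : HasDerivWithinAt M M' s t) (hN : HasDerivWithinAt N N' s t) :
    HasDerivWithinAt (fun u ↦ M u * N u) (M t * N' + M' * N t) s t :=
  (matrixMulCLM l m n).hasDerivWithinAt_of_bilinear hM hN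

theorem ContDiff.matrixMul {E : Type*} [NormedAddCommGroup E] [NormedSpace ℝ E] {k : ℕ∞}
    {M : E → Matrix l m ℝ} {N : E → Matrix m n ℝ} (hM : ContDiff ℝ k M) (hN : ContDiff ℝ k N) :
    ContDiff ℝ k (fun x ↦ M x * N x) :=
  (matrixMulCLM l m n).isBoundedBilinearMap.contDiff.comp₂ hM hN

theorem HasDerivAt.matrixTranspose {M : ℝ → Matrix m n ℝ} {M' : Matrix m n ℝ} {t : ℝ}
    (hM : HasDerivAt M M' t) : HasDerivAt (fun s ↦ (M s)ᵀ) M'ᵀ t :=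
  (matrixTransposeCLM m n).hasFDerivAt.comp_hasDerivAt t hM

theorem HasDerivAt.matrixInv [DecidableEq n] {M : ℝ → Matrix n n ℝ} {M' : Matrix n n ℝ} {t : ℝ}
    (hM : HasDerivAt M M' t) (ht : IsUnit (M t).det) :
    HasDerivAt (fun s ↦ (M s)⁻¹) (-((M t)⁻¹ * M' * (M t)⁻¹)) t := by
  have hdet : ContinuousAt (fun s ↦ (M s).det) t :=
    (continuous_id.matrix_det).continuousAt.comp hM.continuousAt
  have hinv : ContinuousAt (fun s ↦ (M s)⁻¹) t := by
    have hadj : ContinuousAt (fun s ↦ (M s).adjugate) t :=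
      (continuous_id.matrix_adjugate).continuousAt.comp hM.continuousAt
    simp only [Matrix.inv_def, Ring.inverse_eq_inv']
    exact (hdet.inv₀ ht.ne_zero).smul hadj
  have hslope := hasDerivAt_iff_tendsto_slope.1 hM
  refine hasDerivAt_iff_tendsto_slope.2 ?_
  have hlim : Tendsto (fun s ↦ -((M s)⁻¹ * slope M t s * (M t)⁻¹)) (𝓝[≠] t)
      (𝓝 (-((M t)⁻¹ * M' * (M t)⁻¹))) :=
    (((hinv.tendsto.mono_left nhdsWithin_le_nhds).mul hslope).mul tendsto_const_nhds).neg
  refine hlim.congr' ?_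
  filter_upwards [(hdet.eventually_ne ht.ne_zero).filter_mono nhdsWithin_le_nhds] with s hs
  have hs' : IsUnit (M s).det := isUnit_iff_ne_zero.2 hs
  simp only [slope_def_module, Matrix.mul_smul, Matrix.smul_mul, ← smul_neg, Matrix.mul_sub,
    Matrix.sub_mul, Matrix.nonsing_inv_mul _ hs', Matrix.one_mul, Matrix.mul_assoc,
    Matrix.mul_nonsing_inv _ ht, Matrix.mul_one, neg_sub]

theorem HasDerivAt.matrix_derivWithin_Icc {M : ℝ → Matrix m n ℝ} {M' : Matrix m n ℝ} {a b t : ℝ}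
    (hM : HasDerivAt M M' t) (hab : a < b) (ht : t ∈ Icc a b) :
    derivWithin M (Icc a b) t = M' :=
  hM.hasDerivWithinAt.derivWithin (uniqueDiffOn_Icc hab t ht)

theorem ContDiffOn.matrix_hasDerivWithinAt {M : ℝ → Matrix m n ℝ} {s : Set ℝ} {t : ℝ}
    (hM : ContDiffOn ℝ 1 M s) (ht : t ∈ s) : HasDerivWithinAt M (derivWithin M s t) s t :=
  (hM.differentiableOn one_ne_zero t ht).hasDerivWithinAt

end MatrixCalculus

section ODE

variable {E : Type*} [NormedAddCommGroup E] [NormedSpace ℝ E]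

theorem exists_linear_flow [CompleteSpace E] (L : E →L[ℝ] E) (z₀ : E) :
    ∃ z : ℝ → E, z 0 = z₀ ∧ ∀ s, HasDerivAt z (L (z s)) s := by
  refine ⟨fun s ↦ NormedSpace.exp (s • L) z₀, by simp, fun s ↦ ?_⟩
  have := (hasDerivAt_exp_smul_const' (𝕂 := ℝ) L s).clm_apply (hasDerivAt_const s z₀)
  simpa using this

theorem eqOn_Icc_of_hasDerivWithinAt_of_contDiff {F : E → E} (hF : ContDiff ℝ 1 F) {a b : ℝ}
    {f g : ℝ → E} (hf : ∀ t ∈ Icc a b, HasDerivWithinAt f (F (f t)) (Icc a b) t)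
    (hg : ∀ t ∈ Icc a b, HasDerivWithinAt g (F (g t)) (Icc a b) t) (hb : f b = g b) :
    EqOn f g (Icc a b) := by
  have hfc : ContinuousOn f (Icc a b) := fun t ht ↦ (hf t ht).continuousWithinAt
  have hgc : ContinuousOn g (Icc a b) := fun t ht ↦ (hg t ht).continuousWithinAt
  obtain ⟨K, hK⟩ := LocallyLipschitzOn.exists_lipschitzOnWith_of_compact
    ((isCompact_Icc.image_of_continuousOn hfc).union (isCompact_Icc.image_of_continuousOn hgc))
    hF.locallyLipschitz.locallyLipschitzOn
  have hIic : ∀ t ∈ Ioc a b, Icc a b ∈ 𝓝[Iic t] t := fun t ht ↦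
    mem_of_superset (Icc_mem_nhdsLE_of_mem ⟨ht.1, le_refl t⟩) (Icc_subset_Icc_right ht.2)
  exact ODE_solution_unique_of_mem_Icc_left (v := fun _ ↦ F)
    (s := fun _ ↦ f '' Icc a b ∪ g '' Icc a b) (fun _ _ ↦ hK) hfc
    (fun t ht ↦ (hf t (Ioc_subset_Icc_self ht)).mono_of_mem_nhdsWithin (hIic t ht))
    (fun t ht ↦ .inl (mem_image_of_mem f (Ioc_subset_Icc_self ht))) hgc
    (fun t ht ↦ (hg t (Ioc_subset_Icc_self ht)).mono_of_mem_nhdsWithin (hIic t ht))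
    (fun t ht ↦ .inr (mem_image_of_mem g (Ioc_subset_Icc_self ht))) hb

theorem contDiffOn_one_Icc_of_hasDerivAt {a b : ℝ} (hab : a < b) {f f' : ℝ → E}
    (hf : ∀ t ∈ Icc a b, HasDerivAt f (f' t) t) (hf' : ContinuousOn f' (Icc a b)) :
    ContDiffOn ℝ 1 f (Icc a b) := by
  refine (contDiffOn_one_iff_derivWithin (uniqueDiffOn_Icc hab)).2
    ⟨fun t ht ↦ (hf t ht).differentiableAt.differentiableWithinAt, hf'.congr fun t ht ↦ ?_⟩
  exact (hf t ht).hasDerivWithinAt.derivWithin (uniqueDiffOn_Icc hab t ht)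

end ODE

section Hamiltonian

variable {n k : Type*} [Fintype n] [DecidableEq n] [Fintype k]

theorem exists_hamiltonian_flow_s3 (A S G Q₀ : Matrix n n ℝ) (C D w₀ : Matrix k n ℝ) :
    ∃ (X Y : ℝ → Matrix n n ℝ) (W : ℝ → Matrix k n ℝ), X 0 = 1 ∧ Y 0 = Q₀ ∧ W 0 = w₀ ∧
      (∀ s, HasDerivAt X (S * Y s - A * X s) s) ∧
      (∀ s, HasDerivAt Y (Aᵀ * Y s + G * X s) s) ∧
      ∀ s, HasDerivAt W (-(C * Y s) - D * X s) s := by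
  let L : Matrix n n ℝ × Matrix n n ℝ × Matrix k n ℝ →ₗ[ℝ]
      Matrix n n ℝ × Matrix n n ℝ × Matrix k n ℝ :=
    { toFun := fun z ↦ (S * z.2.1 - A * z.1, Aᵀ * z.2.1 + G * z.1, -(C * z.2.1) - D * z.1)
      map_add' := fun x y ↦ by
        simp only [Prod.fst_add, Prod.snd_add, Matrix.mul_add, Prod.mk_add_mk]
        refine Prod.ext ?_ (Prod.ext ?_ ?_) <;> dsimp only <;> abel
      map_smul' := fun c x ↦ by
        simp [Matrix.mul_smul, smul_sub, smul_add] }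
  obtain ⟨z, h0, hz⟩ := exists_linear_flow L.toContinuousLinearMap ((1, Q₀, w₀) : _ × _ × _)
  refine ⟨fun s ↦ (z s).1, fun s ↦ (z s).2.1, fun s ↦ (z s).2.2, by simp [h0], by simp [h0],
    by simp [h0], fun s ↦ ?_, fun s ↦ ?_, fun s ↦ ?_⟩
  · exact (hz s).fst
  · exact (hz s).snd.fst
  · exact (hz s).snd.snd

variable {A σ G Q₀ : Matrix n n ℝ} {X Y : ℝ → Matrix n n ℝ}

theorem hasDerivAt_transpose_mul_of_hamiltonian {S : Matrix n n ℝ} (hS : Sᵀ = S)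
    (hX : ∀ s, HasDerivAt X (S * Y s - A * X s) s)
    (hY : ∀ s, HasDerivAt Y (Aᵀ * Y s + G * X s) s) (s : ℝ) :
    HasDerivAt (fun s ↦ (X s)ᵀ * Y s) ((Y s)ᵀ * S * Y s + (X s)ᵀ * G * X s) s := by
  refine ((hX s).matrixTranspose.matrixMul (hY s)).congr_deriv ?_
  simp only [Matrix.transpose_sub, Matrix.transpose_mul, hS]
  noncomm_ring

theorem transpose_mul_symm_of_hamiltonian {S : Matrix n n ℝ} (hS : Sᵀ = S) (hG : Gᵀ = G)
    (hQ₀ : Q₀ᵀ = Q₀) (hX0 : X 0 = 1) (hY0 : Y 0 = Q₀)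
    (hX : ∀ s, HasDerivAt X (S * Y s - A * X s) s)
    (hY : ∀ s, HasDerivAt Y (Aᵀ * Y s + G * X s) s) (s : ℝ) :
    (Y s)ᵀ * X s = (X s)ᵀ * Y s := by
  have h := hasDerivAt_transpose_mul_of_hamiltonian hS hX hY
  have hd : ∀ s, HasDerivAt (fun s ↦ ((X s)ᵀ * Y s)ᵀ - (X s)ᵀ * Y s) 0 s := fun s ↦ by
    refine ((h s).matrixTranspose.sub (h s)).congr_deriv ?_
    simp [Matrix.transpose_mul, hS, hG, Matrix.mul_assoc]
  have := is_const_of_deriv_eq_zero (fun s ↦ (hd s).differentiableAt) (fun s ↦ (hd s).deriv) s 0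
  simpa [hX0, hY0, hQ₀, sub_eq_zero] using this

theorem isUnit_det_of_hamiltonian (hG : G.PosSemidef) (hQ₀ : Q₀.PosSemidef)
    (hX0 : X 0 = 1) (hY0 : Y 0 = Q₀)
    (hX : ∀ s, HasDerivAt X (σ * σᵀ * Y s - A * X s) s)
    (hY : ∀ s, HasDerivAt Y (Aᵀ * Y s + G * X s) s) {s : ℝ} (hs : 0 ≤ s) :
    IsUnit (X s).det := by
  rw [isUnit_iff_ne_zero]
  intro hdet
  obtain ⟨v, hv, hXv⟩ := Matrix.exists_mulVec_eq_zero_iff.2 hdet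
  rcases hs.eq_or_lt with rfl | hs
  · exact hv (by simpa [hX0] using hXv)
  let q : Matrix n n ℝ →L[ℝ] ℝ := LinearMap.toContinuousLinearMap
    { toFun := fun M ↦ v ⬝ᵥ M *ᵥ v
      map_add' := fun M N ↦ by simp [Matrix.add_mulVec]
      map_smul' := fun c M ↦ by simp [Matrix.smul_mulVec] }
  let e : Matrix n n ℝ →L[ℝ] (n → ℝ) := LinearMap.toContinuousLinearMap
    { toFun := fun M ↦ M *ᵥ v
      map_add' := fun M N ↦ Matrix.add_mulVec M N v
      map_smul' := fun c M ↦ Matrix.smul_mulVec c M v }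
  have hφ : ∀ u, HasDerivAt (fun u ↦ q ((X u)ᵀ * Y u))
      ((σᵀ *ᵥ Y u *ᵥ v) ⬝ᵥ (σᵀ *ᵥ Y u *ᵥ v) + (X u *ᵥ v) ⬝ᵥ G *ᵥ X u *ᵥ v) u := fun u ↦ by
    refine (q.hasFDerivAt.comp_hasDerivAt u
      (hasDerivAt_transpose_mul_of_hamiltonian (by simp) hX hY u)).congr_deriv ?_
    change v ⬝ᵥ (_ + _) *ᵥ v = _
    rw [Matrix.add_mulVec, dotProduct_add]
    simp only [← Matrix.mulVec_mulVec, Matrix.dotProduct_mulVec,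
      ← Matrix.mulVec_transpose, Matrix.transpose_transpose]
  have hGnn : ∀ u, 0 ≤ (X u *ᵥ v) ⬝ᵥ G *ᵥ X u *ᵥ v := fun u ↦ by
    simpa using hG.dotProduct_mulVec_nonneg (X u *ᵥ v)
  have hσnn : ∀ u, 0 ≤ (σᵀ *ᵥ Y u *ᵥ v) ⬝ᵥ (σᵀ *ᵥ Y u *ᵥ v) := fun u ↦
    Finset.sum_nonneg fun i _ ↦ mul_self_nonneg _
  have hmono : Monotone (fun u ↦ q ((X u)ᵀ * Y u)) :=
    monotone_of_hasDerivAt_nonneg hφ fun u ↦ add_nonneg (hσnn u) (hGnn u)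
  have hφ0 : 0 ≤ q ((X 0)ᵀ * Y 0) := by
    rw [hX0, hY0]
    simpa [q] using hQ₀.dotProduct_mulVec_nonneg v
  have hφs : q ((X s)ᵀ * Y s) = 0 := by
    change v ⬝ᵥ ((X s)ᵀ * Y s) *ᵥ v = 0
    rw [← Matrix.mulVec_mulVec, Matrix.dotProduct_mulVec, Matrix.vecMul_transpose, hXv,
      zero_dotProduct]
  have hφz : ∀ u ∈ Icc 0 s, q ((X u)ᵀ * Y u) = 0 := fun u hu ↦
    le_antisymm ((hmono hu.2).trans_eq hφs) (hφ0.trans (hmono hu.1))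
  have hσY : ∀ u ∈ Icc 0 s, σᵀ *ᵥ Y u *ᵥ v = 0 := fun u hu ↦ by
    have hzero := (uniqueDiffOn_Icc hs u hu).eq_deriv _ ((hφ u).hasDerivWithinAt)
      ((hasDerivWithinAt_const u (Icc 0 s) (0 : ℝ)).congr hφz (hφz u hu))
    exact dotProduct_self_eq_zero.1 (by linarith [hσnn u, hGnn u])
  have hXode : ∀ u ∈ Icc 0 s, HasDerivWithinAt (fun u ↦ X u *ᵥ v)
      ((-A).mulVecLin.toContinuousLinearMap (X u *ᵥ v)) (Icc 0 s) u := fun u hu ↦ by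
    refine (e.hasFDerivAt.comp_hasDerivAt u (hX u)).hasDerivWithinAt.congr_deriv ?_
    change (_ - _) *ᵥ v = (-A) *ᵥ X u *ᵥ v
    rw [Matrix.sub_mulVec, Matrix.neg_mulVec, ← Matrix.mulVec_mulVec, ← Matrix.mulVec_mulVec,
      ← Matrix.mulVec_mulVec, hσY u hu, Matrix.mulVec_zero, zero_sub]
  have hX_zero := eqOn_Icc_of_hasDerivWithinAt_of_contDiff
    (F := (-A).mulVecLin.toContinuousLinearMap) (g := fun _ ↦ 0)
    (ContinuousLinearMap.contDiff _) hXode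
    (fun u _ ↦ by simpa using hasDerivWithinAt_const u (Icc 0 s) (0 : n → ℝ)) hXv
    (left_mem_Icc.2 hs.le)
  exact hv (by simpa [hX0] using hX_zero)

/-- The Hamiltonian flow, read backwards from time `T`, solves the matrix Riccati equation and
provides a fundamental solution `Z` of the associated linear equation. -/
theorem exists_riccati_terminal (A σ : Matrix n n ℝ) {Γ Θ : Matrix n n ℝ} (hΓ : Γ.PosSemidef)
    (hΘ : (-Θ).PosSemidef) (C D θ : Matrix k n ℝ) (T : ℝ) :
    ∃ (P Z : ℝ → Matrix n n ℝ) (V : ℝ → Matrix k n ℝ),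
      P T = Θᵀ + Θ ∧ Z T = 1 ∧ V T = θ ∧
      (∀ t ≤ T, (P t)ᵀ = P t) ∧ (∀ t ≤ T, IsUnit (Z t).det) ∧
      (∀ t ≤ T, HasDerivAt P
        ((Γ + Γ) - P t * A - Aᵀ * P t - P t * (σ * σᵀ) * P t) t) ∧
      (∀ t ≤ T, HasDerivAt Z ((A + σ * σᵀ * P t) * Z t) t) ∧
      ∀ t ≤ T, HasDerivAt V ((D - C * P t) * Z t) t := by
  have hΘt : Θᵀ = Θ := by simpa using hΘ.isHermitian.eq
  have hΓt : Γᵀ = Γ := by simpa using hΓ.isHermitian.eq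
  obtain ⟨X, Y, W, hX0, hY0, hW0, hX, hY, hW⟩ :=
    exists_hamiltonian_flow_s3 A (σ * σᵀ) (Γ + Γ) (-Θ + -Θ) C D θ
  have hunit : ∀ s, 0 ≤ s → IsUnit (X s).det := fun s hs ↦
    isUnit_det_of_hamiltonian (hΓ.add hΓ) (hΘ.add hΘ) hX0 hY0 hX hY hs
  have hsymm := transpose_mul_symm_of_hamiltonian (S := σ * σᵀ) (by simp)
    (by simp [hΓt]) (by simp [hΘt]) hX0 hY0 hX hY
  have hrev : ∀ t : ℝ, HasDerivAt (fun t ↦ T - t) (-1) t := fun t ↦ by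
    simpa using (hasDerivAt_id t).const_sub T
  have hYX : ∀ s, 0 ≤ s → Y s * (X s)⁻¹ * X s = Y s := fun s hs ↦
    Matrix.nonsing_inv_mul_cancel_right _ _ (hunit s hs)
  have hQ : ∀ t ≤ T, HasDerivAt (fun s ↦ Y s * (X s)⁻¹)
      (Y (T - t) * (X (T - t))⁻¹ * A + Aᵀ * (Y (T - t) * (X (T - t))⁻¹)
        - Y (T - t) * (X (T - t))⁻¹ * (σ * σᵀ) * (Y (T - t) * (X (T - t))⁻¹) + (Γ + Γ))
      (T - t) := fun t ht ↦ by
    have hu := hunit (T - t) (by linarith)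
    have hinv := Matrix.mul_nonsing_inv _ hu
    refine ((hY _).matrixMul ((hX _).matrixInv hu)).congr_deriv ?_
    simp only [Matrix.mul_sub, Matrix.sub_mul, Matrix.add_mul, Matrix.mul_neg, Matrix.mul_assoc,
      hinv, Matrix.mul_one]
    abel
  refine ⟨fun t ↦ -(Y (T - t) * (X (T - t))⁻¹), fun t ↦ X (T - t), fun t ↦ W (T - t),
    by simp [hX0, hY0, hΘt], by simp [hX0], by simp [hW0], fun t ht ↦ ?_,
    fun t ht ↦ hunit _ (by linarith), fun t ht ↦ ?_, fun t ht ↦ ?_, fun t ht ↦ ?_⟩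
  · have hu := hunit (T - t) (by linarith)
    have hut : IsUnit (X (T - t))ᵀ.det := by rwa [Matrix.det_transpose]
    rw [Matrix.transpose_neg, Matrix.transpose_mul, Matrix.transpose_nonsing_inv, neg_inj,
      ← Matrix.mul_nonsing_inv_cancel_right (X (T - t)) ((X (T - t))ᵀ⁻¹ * (Y (T - t))ᵀ) hu,
      Matrix.mul_assoc _ _ (X (T - t)), hsymm, Matrix.nonsing_inv_mul_cancel_left _ _ hut]
  · refine ((hQ t ht).scomp t (hrev t)).neg.congr_deriv ?_
    simp only [neg_smul, one_smul, Matrix.neg_mul, Matrix.mul_neg, neg_neg]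
    abel
  · refine ((hX (T - t)).scomp t (hrev t)).congr_deriv ?_
    rw [Matrix.add_mul, Matrix.mul_neg, Matrix.neg_mul, Matrix.mul_assoc (σ * σᵀ),
      hYX _ (by linarith)]
    simp only [neg_smul, one_smul]
    abel
  · refine ((hW (T - t)).scomp t (hrev t)).congr_deriv ?_
    rw [Matrix.sub_mul, Matrix.mul_neg, Matrix.neg_mul, Matrix.mul_assoc C,
      hYX _ (by linarith)]
    simp only [neg_smul, one_smul]
    abel

end Hamiltonian

theorem contDiff_riccatiField {n : Type*} [Fintype n] (A S Γ : Matrix n n ℝ) :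
    ContDiff ℝ 1 (fun M : Matrix n n ℝ ↦
      Γ - (Mᵀ + M) * A - (1 / 2 : ℝ) • ((Mᵀ + M) * S * (Mᵀ + M))) := by
  have hsum : ContDiff ℝ (1 : ℕ∞) (fun M : Matrix n n ℝ ↦ Mᵀ + M) :=
    (matrixTransposeCLM n n).contDiff.add contDiff_id
  exact (contDiff_const.sub (hsum.matrixMul contDiff_const)).sub
    (contDiff_const_smul _ |>.comp ((hsum.matrixMul contDiff_const).matrixMul hsum))

/-- Existence and uniqueness on `[0,T]` of C¹ solutions `R₂ᶠ`, `R₁ᶠ` to the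
Riccati-type terminal value problems associated with the forward price in the QPM.
Negative semidefiniteness of `Θ` is expressed as positive semidefiniteness of `-Θ`. -/
theorem statement3 (n : ℕ) (hn : 1 ≤ n) (T : ℝ) (hT : 0 < T)
    (A σ : Matrix (Fin n) (Fin n) ℝ) (B : Matrix (Fin n) (Fin 1) ℝ)
    (R θ : Matrix (Fin 1) (Fin n) ℝ)
    (Γ : Matrix (Fin n) (Fin n) ℝ) (hΓ : Γ.PosSemidef)
    (Θ : Matrix (Fin n) (Fin n) ℝ) (hΘ : (-Θ).PosSemidef) :
    ∃ R₂ : ℝ → Matrix (Fin n) (Fin n) ℝ,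
      (ContDiffOn ℝ 1 R₂ (Icc 0 T) ∧
        (∀ t ∈ Icc 0 T,
          derivWithin R₂ (Icc 0 T) t + ((R₂ t)ᵀ + R₂ t) * A
            + (1 / 2 : ℝ) • (((R₂ t)ᵀ + R₂ t) * (σ * σᵀ) * ((R₂ t)ᵀ + R₂ t)) - Γ = 0) ∧
        R₂ T = Θ) ∧
      (∀ S : ℝ → Matrix (Fin n) (Fin n) ℝ,
        (ContDiffOn ℝ 1 S (Icc 0 T) ∧
          (∀ t ∈ Icc 0 T,
            derivWithin S (Icc 0 T) t + ((S t)ᵀ + S t) * A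
              + (1 / 2 : ℝ) • (((S t)ᵀ + S t) * (σ * σᵀ) * ((S t)ᵀ + S t)) - Γ = 0) ∧
          S T = Θ) → EqOn S R₂ (Icc 0 T)) ∧
      ∃ R₁ : ℝ → Matrix (Fin 1) (Fin n) ℝ,
        (ContDiffOn ℝ 1 R₁ (Icc 0 T) ∧
          (∀ t ∈ Icc 0 T,
            derivWithin R₁ (Icc 0 T) t + R₁ t * A + Bᵀ * ((R₂ t)ᵀ + R₂ t)
              + R₁ t * (σ * σᵀ) * ((R₂ t)ᵀ + R₂ t) - R = 0) ∧
          R₁ T = θ) ∧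
        (∀ S₁ : ℝ → Matrix (Fin 1) (Fin n) ℝ,
          (ContDiffOn ℝ 1 S₁ (Icc 0 T) ∧
            (∀ t ∈ Icc 0 T,
              derivWithin S₁ (Icc 0 T) t + S₁ t * A + Bᵀ * ((R₂ t)ᵀ + R₂ t)
                + S₁ t * (σ * σᵀ) * ((R₂ t)ᵀ + R₂ t) - R = 0) ∧
            S₁ T = θ) → EqOn S₁ R₁ (Icc 0 T)) := by
  obtain ⟨P, Z, V, hPT, hZT, hVT, hPsymm, hZunit, hP, hZ, hV⟩ :=
    exists_riccati_terminal A σ hΓ hΘ Bᵀ R θ T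
  have hPc : ContinuousOn P (Iic T) := fun t ht ↦ (hP t ht).continuousAt.continuousWithinAt
  have hclip : Continuous (fun u ↦ P (min u T)) :=
    hPc.comp_continuous (continuous_id.min continuous_const) fun u ↦ min_le_right u T
  let g : ℝ → Matrix (Fin n) (Fin n) ℝ := fun u ↦
    Γ - P (min u T) * A - (1 / 2 : ℝ) • (P (min u T) * (σ * σᵀ) * P (min u T))
  have hg : Continuous g :=
    (continuous_const.sub (hclip.matrix_mul continuous_const)).sub
      (((hclip.matrix_mul continuous_const).matrix_mul hclip).const_smul (1 / 2 : ℝ))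
  have hgP : ∀ t ≤ T, g t = Γ - P t * A - (1 / 2 : ℝ) • (P t * (σ * σᵀ) * P t) := fun t ht ↦ by
    simp only [g, min_eq_left ht]
  let R₂ : ℝ → Matrix (Fin n) (Fin n) ℝ := fun t ↦ Θ + ∫ u in T..t, g u
  have hR₂T : R₂ T = Θ := by simp [R₂]
  have hR₂ : ∀ t, HasDerivAt R₂ (g t) t := fun t ↦
    (hg.integral_hasStrictDerivAt T t).hasDerivAt.const_add Θ
  have hR₂P : ∀ t ∈ Icc 0 T, (R₂ t)ᵀ + R₂ t = P t := by
    have heq := eqOn_Icc_of_hasDerivWithinAt_of_contDiff (a := 0) (b := T)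
      (f := fun t ↦ (R₂ t)ᵀ + R₂ t - P t) (g := fun _ ↦ 0) (F := fun _ ↦ 0) contDiff_const
      (fun t ht ↦ ?_) (fun t _ ↦ hasDerivWithinAt_const t _ _) (by simp [hR₂T, hPT])
    · exact fun t ht ↦ sub_eq_zero.1 (heq ht)
    · refine ((((hR₂ t).matrixTranspose.add (hR₂ t)).sub (hP t ht.2)).hasDerivWithinAt).congr_deriv
        ?_
      have hΓt : Γᵀ = Γ := by simpa using hΓ.isHermitian.eq
      simp only [hgP t ht.2, Matrix.transpose_sub, Matrix.transpose_smul, Matrix.transpose_mul,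
        Matrix.transpose_transpose, hPsymm t ht.2, hΓt, Matrix.mul_assoc]
      module
  have hR₁ : ∀ t ≤ T, HasDerivAt (fun t ↦ V t * (Z t)⁻¹)
      (R - Bᵀ * P t - V t * (Z t)⁻¹ * (A + σ * σᵀ * P t)) t := fun t ht ↦ by
    have hinv := Matrix.mul_nonsing_inv _ (hZunit t ht)
    refine ((hV t ht).matrixMul ((hZ t ht).matrixInv (hZunit t ht))).congr_deriv ?_
    simp only [Matrix.mul_assoc, hinv, Matrix.mul_one, Matrix.mul_neg]
    abel
  refine ⟨R₂, ⟨contDiffOn_one_Icc_of_hasDerivAt hT (fun t _ ↦ hR₂ t) hg.continuousOn,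
    fun t ht ↦ ?_, hR₂T⟩, fun S ⟨hS, hSode, hST⟩ ↦ ?_, fun t ↦ V t * (Z t)⁻¹, ⟨?_, ?_, ?_⟩,
    fun S₁ ⟨hS₁, hS₁ode, hS₁T⟩ t ht ↦ ?_⟩
  · rw [(hR₂ t).matrix_derivWithin_Icc hT ht, hR₂P t ht, hgP t ht.2]
    abel
  · refine eqOn_Icc_of_hasDerivWithinAt_of_contDiff (contDiff_riccatiField A (σ * σᵀ) Γ)
      (fun t ht ↦ ?_) (fun t ht ↦ ?_) (hST.trans hR₂T.symm)
    · refine (hS.matrix_hasDerivWithinAt ht).congr_deriv ?_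
      rw [← sub_eq_zero, ← hSode t ht]
      abel
    · refine (hR₂ t).hasDerivWithinAt.congr_deriv ?_
      rw [hR₂P t ht, hgP t ht.2]
  · refine contDiffOn_one_Icc_of_hasDerivAt hT (fun t ht ↦ hR₁ t ht.2) fun t ht ↦ ?_
    have hPt := (hP t ht.2).continuousAt
    have hR₁t := (hR₁ t ht.2).continuousAt
    exact ContinuousAt.continuousWithinAt (by fun_prop)
  · intro t ht
    rw [(hR₁ t ht.2).matrix_derivWithin_Icc hT ht, hR₂P t ht, Matrix.mul_add,
      ← Matrix.mul_assoc _ (σ * σᵀ)]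
    abel
  · simp [hVT, hZT]
  · have heq := eqOn_Icc_of_hasDerivWithinAt_of_contDiff (a := 0) (b := T)
      (f := fun t ↦ S₁ t * Z t - V t) (g := fun _ ↦ 0) (F := fun _ ↦ 0) contDiff_const
      (fun u hu ↦ ?_) (fun u _ ↦ hasDerivWithinAt_const u _ _) (by simp [hS₁T, hZT, hVT]) ht
    · change S₁ t = V t * (Z t)⁻¹
      rw [← sub_eq_zero.1 heq, Matrix.mul_nonsing_inv_cancel_right _ _ (hZunit t ht.2)]
    · refine (((hS₁.matrix_hasDerivWithinAt hu).matrixMul (hZ u hu.2).hasDerivWithinAt).sub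
        (hV u hu.2).hasDerivWithinAt).congr_deriv ?_
      have hode := hS₁ode u hu
      rw [hR₂P u hu] at hode
      rw [← Matrix.mul_assoc, ← Matrix.add_mul, ← Matrix.sub_mul, Matrix.mul_add,
        ← Matrix.mul_assoc]
      convert Matrix.zero_mul (Z u) using 2
      rw [← hode]
      abel
end
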